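/- Assume every vertex v ≠ r has a minimal mincut X_v, that the sets X_v (v ≠ r) are pairwise distinct, set X_r := V, and assume for each v ≠ r there is a unique vertex p_v ∈ V (the parent of v) such that X_v ⊊ X_{p_v} and no vertex u satisfies X_v ⊊ X_u ⊊ X_{p_v}. Then for every mincut X with r ∉ X there exists a nonempty set S ⊆ X of vertices and a single vertex p ∈ V such that p_u = p for all u ∈ S and X = ⋃_{u∈S} X_u. -/

import Mathlib

open Finset

variable {V : Type*} [Fintype V] [DecidableEq V]

/-- `cutW w X Y` is `C(X,Y) = Σ_{x∈X} Σ_{y∈Y} w(x,y)`. -/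
def cutW (w : V → V → ℝ) (X Y : Finset V) : ℝ := ∑ x ∈ X, ∑ y ∈ Y, w x y

/-- `C(X) := C(X, V ∖ X)`. -/
def cutVal (w : V → V → ℝ) (X : Finset V) : ℝ := cutW w X Xᶜ

/-- A cut is a nonempty proper subset of `V`. -/
def IsCut (X : Finset V) : Prop := X.Nonempty ∧ X ≠ Finset.univ

/-- A mincut is a cut of minimum weight. -/
def IsMincut (w : V → V → ℝ) (X : Finset V) : Prop :=
  IsCut X ∧ ∀ Y : Finset V, IsCut Y → cutVal w X ≤ cutVal w Y

/-- `X` and `Y` cross if `X∩Y`, `X∖Y`, `Y∖X` and `V∖(X∪Y)` are all nonempty. -/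
def Crosses (X Y : Finset V) : Prop :=
  (X ∩ Y).Nonempty ∧ (X \ Y).Nonempty ∧ (Y \ X).Nonempty ∧ ((X ∪ Y)ᶜ).Nonempty

/-- A minimal mincut of a vertex `v`: a mincut containing `v` but not the root `r`,
of minimum cardinality among all such mincuts. -/
def IsMinimalMincutOfVertex (w : V → V → ℝ) (r v : V) (X : Finset V) : Prop :=
  IsMincut w X ∧ v ∈ X ∧ r ∉ X ∧
    ∀ Y : Finset V, IsMincut w Y → v ∈ Y → r ∉ Y → X.card ≤ Y.card

/-- An edge is an unordered pair of distinct vertices with positive weight. -/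
def IsEdge (w : V → V → ℝ) (u₁ u₂ : V) : Prop := u₁ ≠ u₂ ∧ 0 < w u₁ u₂

/-- A minimal mincut of an edge `{u₁,u₂}`: a mincut containing both endpoints but not the
root `r`, of minimum cardinality among all such mincuts. -/
def IsMinimalMincutOfEdge (w : V → V → ℝ) (r u₁ u₂ : V) (X : Finset V) : Prop :=
  IsEdge w u₁ u₂ ∧ IsMincut w X ∧ u₁ ∈ X ∧ u₂ ∈ X ∧ r ∉ X ∧
    ∀ Y : Finset V, IsMincut w Y → u₁ ∈ Y → u₂ ∈ Y → r ∉ Y → X.card ≤ Y.card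

lemma cutVal_eq_ind (w : V → V → ℝ) (A : Finset V) :
    cutVal w A = ∑ x, ∑ y, if x ∈ A ∧ y ∉ A then w x y else 0 := by
  unfold cutVal cutW
  have h1 : ∀ f : V → ℝ, ∀ B : Finset V, ∑ x ∈ B, f x = ∑ x, if x ∈ B then f x else 0 := by
    intro f B
    simp
  rw [h1]
  refine Finset.sum_congr rfl fun x _ => ?_
  rw [h1]
  by_cases hx : x ∈ A <;> simp [hx]

lemma cutVal_submod (w : V → V → ℝ) (hn : ∀ x y, 0 ≤ w x y) (A B : Finset V) :
    cutVal w (A ∩ B) + cutVal w (A ∪ B) ≤ cutVal w A + cutVal w B := by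
  simp only [cutVal_eq_ind, ← Finset.sum_add_distrib]
  refine Finset.sum_le_sum fun x _ => Finset.sum_le_sum fun y _ => ?_
  have := hn x y
  by_cases h1 : x ∈ A <;> by_cases h2 : x ∈ B <;> by_cases h3 : y ∈ A <;>
    by_cases h4 : y ∈ B <;> simp [h1, h2, h3, h4, this]

lemma cutVal_compl (w : V → V → ℝ) (hs : ∀ x y, w x y = w y x) (A : Finset V) :
    cutVal w Aᶜ = cutVal w A := by
  unfold cutVal cutW
  rw [compl_compl, Finset.sum_comm]
  exact Finset.sum_congr rfl fun x _ => Finset.sum_congr rfl fun y _ => hs _ _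

lemma IsMincut.inter' {w : V → V → ℝ} (hn : ∀ x y, 0 ≤ w x y) {A B : Finset V}
    (hA : IsMincut w A) (hB : IsMincut w B) {a b : V} (ha : a ∈ A) (ha' : a ∈ B)
    (hb : b ∉ A) (hb' : b ∉ B) : IsMincut w (A ∩ B) := by
  have hI : IsCut (A ∩ B) := ⟨⟨a, by simp [ha, ha']⟩, fun h => hb (by
    have : b ∈ A ∩ B := h ▸ Finset.mem_univ b
    exact (Finset.mem_inter.1 this).1)⟩
  have hU : IsCut (A ∪ B) := ⟨⟨a, by simp [ha]⟩, fun h => by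
    have : b ∈ A ∪ B := h ▸ Finset.mem_univ b
    simp [hb, hb'] at this⟩
  refine ⟨hI, fun Z hZ => ?_⟩
  have := cutVal_submod w hn A B
  have := hA.2 _ hU
  have := hB.2 _ hZ
  linarith

lemma IsMincut.compl' {w : V → V → ℝ} (hs : ∀ x y, w x y = w y x) {A : Finset V}
    (hA : IsMincut w A) : IsMincut w Aᶜ := by
  refine ⟨⟨?_, ?_⟩, fun Z hZ => ?_⟩
  · rw [Finset.nonempty_iff_ne_empty, Ne, Finset.compl_eq_empty_iff]
    exact hA.1.2
  · rw [Ne, Finset.compl_eq_univ_iff]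
    exact hA.1.1.ne_empty
  · rw [cutVal_compl w hs]
    exact hA.2 Z hZ

/-- with minimal mincuts `X v` of all vertices (pairwise distinct, `X r = V`)
and the (unique) parent map `p`, every mincut `Y` with `r ∉ Y` is the union `⋃_{u∈S} X u`
over a nonempty set `S ⊆ Y` of vertices having a common parent. -/
theorem mincut_is_union_of_siblings
    (r : V) (w : V → V → ℝ)
    (hcard : 1 < Fintype.card V)
    (hsym : ∀ x y, w x y = w y x)
    (hnonneg : ∀ x y, 0 ≤ w x y)
    (hdiag : ∀ x, w x x = 0)
    (X : V → Finset V) (p : V → V)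
    (hXr : X r = Finset.univ)
    (hX : ∀ v : V, v ≠ r → IsMinimalMincutOfVertex w r v (X v))
    (hdist : ∀ u v : V, u ≠ r → v ≠ r → u ≠ v → X u ≠ X v)
    (hp : ∀ v : V, v ≠ r →
      X v ⊂ X (p v) ∧ ∀ u : V, ¬ (X v ⊂ X u ∧ X u ⊂ X (p v)))
    (hpu : ∀ v : V, v ≠ r → ∀ q : V,
      (X v ⊂ X q ∧ ∀ u : V, ¬ (X v ⊂ X u ∧ X u ⊂ X q)) → q = p v)
    (Y : Finset V) (hY : IsMincut w Y) (hrY : r ∉ Y) :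
    ∃ S : Finset V, S.Nonempty ∧ S ⊆ Y ∧ (∃ q : V, ∀ u ∈ S, p u = q) ∧
      Y = S.biUnion X := by
  have hmem : ∀ v, v ∈ X v := by
    intro v
    by_cases h : v = r
    · subst h; simp [hXr]
    · exact (hX v h).2.1
  -- minimal mincuts are contained in every mincut of the vertex
  have hsub : ∀ v Z, IsMincut w Z → v ∈ Z → r ∉ Z → X v ⊆ Z := by
    intro v Z hZ hv hr
    have hvr : v ≠ r := fun h => hr (h ▸ hv)
    obtain ⟨h1, h2, h3, h4⟩ := hX v hvr
    have h5 := h4 _ (h1.inter' hnonneg hZ h2 hv h3 hr) (by simp [h2, hv]) (by simp [h3])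
    exact Finset.inter_eq_left.1 (Finset.eq_of_subset_of_card_le Finset.inter_subset_left h5)
  -- a mincut avoiding v that meets X v is contained in X v
  have hin : ∀ v Z, IsMincut w Z → v ∉ Z → r ∉ Z → ∀ a ∈ Z, a ∈ X v → Z ⊆ X v := by
    intro v Z hZ hv hr a ha ha'
    by_cases hvr : v = r
    · subst hvr; simp [hXr]
    intro b hb
    by_contra hbX
    obtain ⟨h1, h2, h3, h4⟩ := hX v hvr
    have h5 := h4 _ (h1.inter' hnonneg (hZ.compl' hsym) h2 (by simpa using hv) hbX
      (by simpa using hb)) (by simp [h2, hv]) (by simp [h3])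
    have h6 := Finset.inter_eq_left.1
      (Finset.eq_of_subset_of_card_le Finset.inter_subset_left h5) ha'
    simp [ha] at h6
  -- comparability
  have hcomp : ∀ u v a, a ∈ X u → a ∈ X v → X u ⊆ X v ∨ X v ⊆ X u := by
    intro u v a hu hv
    by_cases hur : u = r
    · subst hur; right; simp [hXr]
    by_cases hvr : v = r
    · subst hvr; left; simp [hXr]
    by_cases h : u ∈ X v
    · exact Or.inl (hsub u _ (hX v hvr).1 h (hX v hvr).2.2.1)
    · exact Or.inr (hin u _ (hX v hvr).1 h (hX v hvr).2.2.1 a hv hu)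
  have hinj : ∀ u v, X u = X v → u = v := by
    intro u v h
    by_cases hur : u = r
    · by_contra hne
      have hvr : v ≠ r := fun h' => hne (hur.trans h'.symm)
      apply (hX v hvr).2.2.1
      rw [← h, hur]; exact hmem r
    · by_cases hvr : v = r
      · exfalso
        apply (hX u hur).2.2.1
        rw [h, hvr]; exact hmem r
      · by_contra hne
        exact hdist u v hur hvr hne h
  let S : Finset V := Y.filter fun u => ∀ v ∈ Y, ¬ X u ⊂ X v
  have hSY : S ⊆ Y := Finset.filter_subset _ _
  have hne : ∀ u ∈ Y, u ≠ r := fun u hu h => hrY (h ▸ hu)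
  have hcov : ∀ y ∈ Y, ∃ u ∈ S, y ∈ X u := by
    intro y hy
    obtain ⟨u, hu, hmax⟩ := Finset.exists_max_image (Y.filter fun u => y ∈ X u)
      (fun u => (X u).card) ⟨y, by simp [hy, hmem]⟩
    simp only [Finset.mem_filter] at hu hmax
    refine ⟨u, Finset.mem_filter.2 ⟨hu.1, fun v hv hlt => ?_⟩, hu.2⟩
    have := hmax v ⟨hv, hlt.1 hu.2⟩
    exact absurd (Finset.card_lt_card hlt) (by omega)
  have hpar : ∀ u ∈ S, p u ∉ Y ∧ Y ⊆ X (p u) := by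
    intro u hu
    obtain ⟨huY, humax⟩ := Finset.mem_filter.1 hu
    have h1 := (hp u (hne u huY)).1
    have h2 : p u ∉ Y := fun h => humax _ h h1
    exact ⟨h2, hin _ Y hY h2 hrY u huY (h1.1 (hmem u))⟩
  have key : ∀ u ∈ S, ∀ v ∈ S, X (p v) ⊆ X (p u) → X (p u) = X (p v) := by
    intro u hu v hv hle
    by_contra hneq
    have huY := hSY hu
    refine (hp u (hne u huY)).2 (p v)
      ⟨?_, Finset.ssubset_iff_subset_ne.2 ⟨hle, fun h => hneq h.symm⟩⟩
    have h1 := hsub u Y hY huY hrY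
    exact ⟨h1.trans (hpar v hv).2, fun h => (hpar v hv).1 (h1 (h (hmem _)))⟩
  obtain ⟨y, hy⟩ := hY.1.1
  obtain ⟨u₀, hu₀, -⟩ := hcov y hy
  refine ⟨S, ⟨u₀, hu₀⟩, hSY, ⟨p u₀, fun u hu => hinj _ _ ?_⟩, ?_⟩
  · rcases hcomp (p u) (p u₀) y ((hpar u hu).2 hy) ((hpar u₀ hu₀).2 hy) with h | h
    · exact (key u₀ hu₀ u hu h).symm
    · exact key u hu u₀ hu₀ h
  · apply Finset.Subset.antisymm
    · intro z hz
      obtain ⟨u, hu, hzu⟩ := hcov z hz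
      exact Finset.mem_biUnion.2 ⟨u, hu, hzu⟩
    · exact Finset.biUnion_subset.2 fun u hu => hsub u Y hY (hSY hu) hrY
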